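/- arXiv:1903.09334 — 4 statements merged into one kernel-verified Lean document; each statement's English description precedes it below -/
import Mathlib

section
/- Let q be a prime power, n a positive integer, and V a k-dimensional F_q-subspace of F_{q^n} with k ≥ 1. Then the orbit orb(V) = {αV : α ∈ F_{q^n}, α ≠ 0} has cardinality (q^n − 1)/(q^t − 1) for some positive integer t dividing n. -/
open Module

/-- The cyclic shift `αV = {αv : v ∈ V}` of an `Fq`-subspace `V` of the extension field `F`
by a field element `α`. -/
def cyclicShift (Fq F : Type*) [Field Fq] [Field F] [Algebra Fq F]
    (α : F) (V : Submodule Fq F) : Submodule Fq F :=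
  Submodule.map (LinearMap.mulLeft Fq α) V

/-- The subspace distance `d(U,W) = dim U + dim W − 2 dim (U ∩ W)`. -/
noncomputable def subspaceDist (Fq F : Type*) [Field Fq] [Field F] [Algebra Fq F]
    (U W : Submodule Fq F) : ℕ :=
  finrank Fq U + finrank Fq W - 2 * finrank Fq ↥(U ⊓ W)

/-- `C` is a cyclic code in the Grassmannian `G_q(n,k)` (all members have dimension `k`,
and `C` is closed under cyclic shifts by nonzero field elements) with minimum subspace
distance at least `d`. -/
def IsCyclicCode (Fq F : Type*) [Field Fq] [Field F] [Algebra Fq F]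
    (k d : ℕ) (C : Set (Submodule Fq F)) : Prop :=
  (∀ U ∈ C, finrank Fq U = k) ∧
  (∀ α : F, α ≠ 0 → ∀ U ∈ C, cyclicShift Fq F α U ∈ C) ∧
  (∀ U ∈ C, ∀ W ∈ C, U ≠ W → d ≤ subspaceDist Fq F U W)

/-- The orbit `orb(V) = {αV : α ∈ F, α ≠ 0}` of a subspace `V`. -/
def orbitOf (Fq F : Type*) [Field Fq] [Field F] [Algebra Fq F]
    (V : Submodule Fq F) : Set (Submodule Fq F) :=
  {W | ∃ α : F, α ≠ 0 ∧ W = cyclicShift Fq F α V}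

/-- The set of orbits of members of a code `C`. -/
def orbitsOf (Fq F : Type*) [Field Fq] [Field F] [Algebra Fq F]
    (C : Set (Submodule Fq F)) : Set (Set (Submodule Fq F)) :=
  {O | ∃ V ∈ C, O = orbitOf Fq F V}

open scoped Pointwise

section Stabilizer

variable {K L : Type*} [Field K] [Field L] [Algebra K L]

/-- The subalgebra of multipliers `a` of a subspace `V`, that is, those with `aV ⊆ V`. -/
def multiplierSubalgebra (V : Submodule K L) : Subalgebra K L where
  carrier := {a | ∀ v ∈ V, a * v ∈ V}
  mul_mem' ha hb v hv := by
    rw [mul_assoc]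
    exact ha _ (hb v hv)
  add_mem' ha hb v hv := by
    rw [add_mul]
    exact V.add_mem (ha v hv) (hb v hv)
  algebraMap_mem' r v hv := by
    rw [← Algebra.smul_def]
    exact V.smul_mem r hv

/-- In an algebraic extension, the multipliers of a subspace form an intermediate field. -/
def multiplierField [Algebra.IsAlgebraic K L] (V : Submodule K L) : IntermediateField K L :=
  subalgebraEquivIntermediateField (multiplierSubalgebra V)

theorem mem_multiplierField [Algebra.IsAlgebraic K L] {V : Submodule K L} {a : L} :
    a ∈ multiplierField V ↔ ∀ v ∈ V, a * v ∈ V :=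
  mem_subalgebraEquivIntermediateField

theorem cyclicShift_units (a : Lˣ) (V : Submodule K L) :
    cyclicShift K L a V = a • V :=
  rfl

theorem orbitOf_eq_orbit (V : Submodule K L) :
    orbitOf K L V = MulAction.orbit Lˣ V := by
  ext W
  constructor
  · rintro ⟨a, ha, rfl⟩
    exact ⟨Units.mk0 a ha, rfl⟩
  · rintro ⟨a, rfl⟩
    exact ⟨a, a.ne_zero, rfl⟩

theorem mem_stabilizer_iff_mem_multiplierField [Algebra.IsAlgebraic K L]
    {V : Submodule K L} {a : Lˣ} :
    a ∈ MulAction.stabilizer Lˣ V ↔ (a : L) ∈ multiplierField V := by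
  have smul_le {b : Lˣ} (hb : (b : L) ∈ multiplierField V) : b • V ≤ V := by
    rintro _ ⟨v, hv, rfl⟩
    exact mem_multiplierField.1 hb v hv
  rw [MulAction.mem_stabilizer_iff]
  constructor
  · intro h
    refine mem_multiplierField.2 fun v hv => ?_
    have hav : a • v ∈ a • V := Submodule.smul_mem_pointwise_smul v a V hv
    rwa [h] at hav
  · intro h
    refine le_antisymm (smul_le h) fun v hv => ?_
    have hinv : ((a⁻¹ : Lˣ) : L) ∈ multiplierField V := by
      rw [Units.val_inv_eq_inv_val]
      exact inv_mem h
    exact ⟨a⁻¹ • v, mem_multiplierField.1 hinv v hv, smul_inv_smul a v⟩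

/-- The stabilizer of a subspace is the unit group of its field of multipliers. -/
def stabilizerEquivUnits [Algebra.IsAlgebraic K L] (V : Submodule K L) :
    MulAction.stabilizer Lˣ V ≃ (multiplierField V)ˣ where
  toFun a := Units.mk0 ⟨a.1, mem_stabilizer_iff_mem_multiplierField.1 a.2⟩
    fun h => a.1.ne_zero (congrArg Subtype.val h)
  invFun b := ⟨Units.map (multiplierField V).val.toMonoidHom b,
    mem_stabilizer_iff_mem_multiplierField.2 b.1.2⟩
  left_inv a := by ext; rfl
  right_inv b := by ext; rfl

theorem ncard_orbitOf_mul [Finite L] (V : Submodule K L) :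
    (orbitOf K L V).ncard * (Nat.card (multiplierField V) - 1) = Nat.card L - 1 := by
  rw [← Nat.card_units, ← Nat.card_units, ← Nat.card_congr (stabilizerEquivUnits V),
    orbitOf_eq_orbit, ← Nat.card_coe_set_eq, ← Nat.card_prod]
  exact Nat.card_congr (MulAction.orbitProdStabilizerEquivGroup Lˣ V)

end Stabilizer

/-- the orbit of a `k`-dimensional subspace (`k ≥ 1`) of `F_{q^n}` has
cardinality `(q^n − 1)/(q^t − 1)` for some positive divisor `t` of `n`. -/
theorem orbit_card_eq
    (q n k : ℕ) (hq : IsPrimePow q) (hn : 0 < n) (hk : 1 ≤ k)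
    (Fq F : Type*) [Field Fq] [Fintype Fq] [Field F] [Algebra Fq F]
    (hcard : Fintype.card Fq = q) (hrank : finrank Fq F = n)
    (V : Submodule Fq F) (hV : finrank Fq V = k) :
    ∃ t : ℕ, 0 < t ∧ t ∣ n ∧ (orbitOf Fq F V).ncard = (q ^ n - 1) / (q ^ t - 1) := by
  subst hcard
  have : FiniteDimensional Fq F := FiniteDimensional.of_finrank_pos (hrank ▸ hn)
  have : Finite F := Module.finite_of_finite Fq
  have hpos : 0 < finrank Fq (multiplierField V) := finrank_pos
  refine ⟨finrank Fq (multiplierField V), hpos,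
    ⟨finrank (multiplierField V) F, ?_⟩, ?_⟩
  · rw [← hrank, finrank_mul_finrank]
  · have h := ncard_orbitOf_mul V
    rw [Module.natCard_eq_pow_finrank (K := Fq) (V := multiplierField V),
      Module.natCard_eq_pow_finrank (K := Fq) (V := F), hrank, Nat.card_eq_fintype_card] at h
    have hlt := Nat.one_lt_pow hpos.ne' (Fintype.one_lt_card (α := Fq))
    exact (Nat.div_eq_of_eq_mul_left (Nat.sub_pos_of_lt hlt) h.symm).symm
end

section
/- 𝒞_2(4,4,2) = 5; that is, the maximum cardinality of a cyclic code C ⊆ G_2(4,2) with minimum subspace distance at least 4 equals 5. -/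
open Module

/-- A subspace of `𝔽₂`-dimension two has three nonzero vectors. -/
theorem ncard_nonzero_of_finrank_eq_two {F : Type*} [Field F] [Algebra (ZMod 2) F] [Finite F]
    {U : Submodule (ZMod 2) F} (hU : finrank (ZMod 2) U = 2) :
    ((U : Set F) \ {0}).ncard = 3 := by
  have h : (U : Set F).ncard = 4 := by
    have h1 := Module.natCard_eq_pow_finrank (K := ZMod 2) (V := U)
    rw [hU, Nat.card_zmod] at h1
    rw [← Nat.card_coe_set_eq]
    exact h1
  rw [Set.ncard_sdiff_singleton_of_mem U.zero_mem, h]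

/-- Counting nonzero vectors in a family of planes with pairwise trivial intersection. -/
theorem ncard_iUnion_nonzero {F : Type*} [Field F] [Algebra (ZMod 2) F] [Finite F]
    {C : Set (Submodule (ZMod 2) F)} (hdim : ∀ U ∈ C, finrank (ZMod 2) U = 2)
    (hinf : ∀ U ∈ C, ∀ W ∈ C, U ≠ W → U ⊓ W = ⊥) :
    (⋃ U ∈ C, (U : Set F) \ {0}).ncard = 3 * C.ncard := by
  classical
  have hC : C.Finite := Set.toFinite C
  have hd : C.PairwiseDisjoint fun U : Submodule (ZMod 2) F => (U : Set F) \ {0} := by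
    intro U hU W hW hne
    refine Set.disjoint_left.2 fun x hx hx' => hx.2 ?_
    have : x ∈ U ⊓ W := ⟨hx.1, hx'.1⟩
    rw [hinf U hU W hW hne] at this
    simpa using this
  rw [hC.ncard_biUnion (fun _ _ => Set.toFinite _) hd,
    finsum_mem_congr rfl fun U hU => ncard_nonzero_of_finrank_eq_two (hdim U hU),
    Set.ncard_eq_toFinset_card C hC, finsum_mem_eq_finite_toFinset_sum _ hC]
  simp [mul_comm]

theorem ncard_nonzero_galoisField :
    ({0}ᶜ : Set (GaloisField 2 4)).ncard = 15 := by
  have h := GaloisField.card 2 4 (by norm_num)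
  have h1 := Set.ncard_add_ncard_compl ({0} : Set (GaloisField 2 4))
  rw [Set.ncard_singleton, h] at h1
  omega

theorem mem_cyclicShift {Fq F : Type*} [Field Fq] [Field F] [Algebra Fq F]
    {α x : F} {V : Submodule Fq F} :
    x ∈ cyclicShift Fq F α V ↔ ∃ v ∈ V, α * v = x := Iff.rfl

theorem finrank_cyclicShift {Fq F : Type*} [Field Fq] [Field F] [Algebra Fq F]
    {α : F} (hα : α ≠ 0) (V : Submodule Fq F) :
    finrank Fq (cyclicShift Fq F α V) = finrank Fq V :=
  (Submodule.equivMapOfInjective _ (mul_right_injective₀ hα) V).finrank_eq.symm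

theorem cyclicShift_cyclicShift {Fq F : Type*} [Field Fq] [Field F] [Algebra Fq F]
    (α β : F) (V : Submodule Fq F) :
    cyclicShift Fq F α (cyclicShift Fq F β V) = cyclicShift Fq F (α * β) V := by
  ext x
  simp only [mem_cyclicShift]
  constructor
  · rintro ⟨_, ⟨v, hv, rfl⟩, rfl⟩
    exact ⟨v, hv, mul_assoc ..⟩
  · rintro ⟨v, hv, rfl⟩
    exact ⟨_, ⟨v, hv, rfl⟩, (mul_assoc ..).symm⟩

/-- A subspace closed under multiplication is fixed by the shift by any of its nonzero
elements. -/
theorem cyclicShift_eq_self {Fq F : Type*} [Field Fq] [Field F] [Algebra Fq F]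
    [FiniteDimensional Fq F] {K : Submodule Fq F} (hmul : ∀ x ∈ K, ∀ y ∈ K, x * y ∈ K)
    {x : F} (hx : x ∈ K) (hx0 : x ≠ 0) : cyclicShift Fq F x K = K := by
  refine Submodule.eq_of_le_of_finrank_eq ?_ (finrank_cyclicShift hx0 K)
  rintro _ ⟨v, hv, rfl⟩
  exact hmul x hx v hv

/-- The shifts of a subspace closed under multiplication meet pairwise trivially. -/
theorem cyclicShift_inf_eq_bot {Fq F : Type*} [Field Fq] [Field F] [Algebra Fq F]
    [FiniteDimensional Fq F] {K : Submodule Fq F} (hmul : ∀ x ∈ K, ∀ y ∈ K, x * y ∈ K)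
    {α β : F} (hne : cyclicShift Fq F α K ≠ cyclicShift Fq F β K) :
    cyclicShift Fq F α K ⊓ cyclicShift Fq F β K = ⊥ := by
  rw [Submodule.eq_bot_iff]
  rintro v ⟨⟨x, hx, rfl⟩, ⟨y, hy, hxy⟩⟩
  simp only [LinearMap.mulLeft_apply] at hxy ⊢
  by_contra h0
  have hx0 : x ≠ 0 := right_ne_zero_of_mul h0
  have hy0 : y ≠ 0 := right_ne_zero_of_mul (hxy ▸ h0)
  apply hne
  rw [← cyclicShift_eq_self hmul hx hx0, cyclicShift_cyclicShift, ← hxy,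
    ← cyclicShift_cyclicShift, cyclicShift_eq_self hmul hy hy0,
    cyclicShift_eq_self hmul hx hx0]

/-- `GaloisField 2 4` contains a copy of the field with four elements. -/
theorem exists_quaternary_subspace :
    ∃ K : Submodule (ZMod 2) (GaloisField 2 4), finrank (ZMod 2) K = 2 ∧ 1 ∈ K ∧
      ∀ x ∈ K, ∀ y ∈ K, x * y ∈ K := by
  have hcard : Nat.card (GaloisField 2 4)ˣ = 15 := by
    rw [Nat.card_units, GaloisField.card 2 4 (by norm_num)]
    norm_num
  obtain ⟨u, hu⟩ := exists_prime_orderOf_dvd_card' (G := (GaloisField 2 4)ˣ) 3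
    (by rw [hcard]; norm_num)
  obtain ⟨w, hw⟩ : ∃ w : GaloisField 2 4, w = u := ⟨_, rfl⟩
  have hw3 : w ^ 3 = 1 := by
    rw [hw, ← Units.val_pow_eq_pow_val, ← hu, pow_orderOf_eq_one, Units.val_one]
  have hw0 : w ≠ 0 := hw ▸ u.ne_zero
  have hw1 : w ≠ 1 := by
    intro h
    have : u = 1 := Units.ext (by rw [← hw, h, Units.val_one])
    rw [this, orderOf_one] at hu
    norm_num at hu
  have h2 : (2 : GaloisField 2 4) = 0 := CharTwo.two_eq_zero
  have hsq : w * w = 1 + w := by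
    have h : (w - 1) * (w * w + w + 1) = 0 := by linear_combination hw3
    have := (mul_eq_zero.1 h).resolve_left (sub_ne_zero.2 hw1)
    linear_combination this - (1 + w) * h2
  refine ⟨Submodule.span (ZMod 2) (Set.range ![1, w]), ?_, ?_, ?_⟩
  · have hli : LinearIndependent (ZMod 2) ![1, w] := by
      rw [LinearIndependent.pair_iff]
      intro s t h
      have hbit : ∀ a : ZMod 2, a = 0 ∨ a = 1 := by decide
      obtain rfl | rfl := hbit s <;> obtain rfl | rfl := hbit t
      · exact ⟨rfl, rfl⟩
      · simp [hw0] at h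
      · simp at h
      · refine absurd ?_ hw1
        have h' : (1 : GaloisField 2 4) + w = 0 := by simpa using h
        linear_combination h' - h2
    rw [finrank_span_eq_card hli, Fintype.card_fin]
  · exact Submodule.subset_span ⟨0, rfl⟩
  · intro x hx y hy
    rw [Matrix.range_cons, Matrix.range_cons, Matrix.range_empty, Set.union_empty,
      Set.singleton_union, Submodule.mem_span_pair] at hx hy ⊢
    obtain ⟨a, b, rfl⟩ := hx
    obtain ⟨c, d, rfl⟩ := hy
    refine ⟨a * c + b * d, a * d + b * c + b * d, ?_⟩
    simp only [Algebra.smul_def, map_add, map_mul]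
    linear_combination
      -(algebraMap (ZMod 2) (GaloisField 2 4) b * algebraMap (ZMod 2) (GaloisField 2 4) d) * hsq

/-- 𝒞_2(4,4,2) = 5. -/
theorem C2_greatest :
    IsGreatest {m : ℕ | ∃ C : Set (Submodule (ZMod 2) (GaloisField 2 4)),
      IsCyclicCode (ZMod 2) (GaloisField 2 4) 2 4 C ∧ C.ncard = m} 5 := by
  constructor
  · obtain ⟨K, hK, h1, hmul⟩ := exists_quaternary_subspace
    have hdim : ∀ U ∈ orbitOf (ZMod 2) (GaloisField 2 4) K, finrank (ZMod 2) U = 2 := by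
      rintro _ ⟨α, hα, rfl⟩
      rw [finrank_cyclicShift hα, hK]
    have hinf : ∀ U ∈ orbitOf (ZMod 2) (GaloisField 2 4) K,
        ∀ W ∈ orbitOf (ZMod 2) (GaloisField 2 4) K, U ≠ W → U ⊓ W = ⊥ := by
      rintro _ ⟨α, -, rfl⟩ _ ⟨β, -, rfl⟩ hne
      exact cyclicShift_inf_eq_bot hmul hne
    refine ⟨orbitOf (ZMod 2) (GaloisField 2 4) K, ⟨hdim, ?_, ?_⟩, ?_⟩
    · rintro α hα _ ⟨β, hβ, rfl⟩
      exact ⟨α * β, mul_ne_zero hα hβ, cyclicShift_cyclicShift α β K⟩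
    · intro U hU W hW hne
      rw [subspaceDist, hdim U hU, hdim W hW, hinf U hU W hW hne, finrank_bot]
    · have hcover : (⋃ U ∈ orbitOf (ZMod 2) (GaloisField 2 4) K,
          (U : Set (GaloisField 2 4)) \ {0}) = {0}ᶜ := by
        ext x
        simp only [Set.mem_iUnion, exists_prop]
        constructor
        · rintro ⟨_, -, hx⟩
          exact hx.2
        · intro hx
          exact ⟨_, ⟨x, hx, rfl⟩, ⟨1, h1, mul_one x⟩, hx⟩
      have h := ncard_iUnion_nonzero hdim hinf
      rw [hcover, ncard_nonzero_galoisField] at h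
      omega
  · rintro m ⟨C, ⟨hdim, -, hdist⟩, rfl⟩
    have hinf : ∀ U ∈ C, ∀ W ∈ C, U ≠ W → U ⊓ W = ⊥ := by
      intro U hU W hW hne
      have h := hdist U hU W hW hne
      rw [subspaceDist, hdim U hU, hdim W hW] at h
      exact Submodule.finrank_eq_zero.1 (by omega)
    have h := ncard_iUnion_nonzero hdim hinf
    have hle := Set.ncard_le_ncard (t := ({0}ᶜ : Set (GaloisField 2 4)))
      (Set.iUnion₂_subset fun U (_ : U ∈ C) x (hx : x ∈ (U : Set (GaloisField 2 4)) \ {0}) => hx.2)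
      (Set.toFinite _)
    rw [h, ncard_nonzero_galoisField] at hle
    omega
end

section
/- Every cyclic code C ⊆ G_2(7,3) with minimum subspace distance at least 4 contains at most 2 orbits; equivalently, since every orbit in G_2(7,3) has 127 subspaces, |C| ≤ 254. -/
open Module

/-! ### Search for difference families -/

/-- The table of Zech logarithms for a root `g` of `X ^ 7 + X + 1` over the field with two
elements: `g ^ zech i = 1 + g ^ i` for `0 < i < 127`. -/
def zech (i : ℕ) : ℕ :=
  (196608619116723936011800157951820671983607291825537733009497394679129778594399985055675555367516648939382182204959597580161417125479201016252726302677033694962012784611364252272385511901972129792613782284764846262804452937923581790549597951662927609858182526418518912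
    >>> (7 * i)) % 128

/-- The exponent of `g ^ p / g ^ q`. -/
def logSub (p q : ℕ) : ℕ := (127 + p - q) % 127

/-- The exponent of `g ^ p + g ^ q`. -/
def logAdd (p q : ℕ) : ℕ := (p + zech (logSub q p)) % 127

/-- The exponents of the nonzero elements of the plane spanned by `1`, `g ^ i` and `g ^ j`. -/
def planeLogs (i j : ℕ) : List ℕ :=
  [0, i, zech i, j, zech j, logAdd i j, zech (logAdd i j)]

/-- The exponents of the ratios of distinct nonzero elements of the plane spanned by
`1`, `g ^ i` and `g ^ j`. -/
def planeRatios (i j : ℕ) : List ℕ :=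
  ((planeLogs i j ×ˢ planeLogs i j).filter fun p => p.1 != p.2).map fun p => logSub p.1 p.2

/-- Whether `j` is the least exponent of an element of the plane spanned by `1`, `g ^ i` and
`g ^ j` that lies outside the line spanned by `1` and `g ^ i`. -/
def isLeastLog (i j : ℕ) : Bool :=
  j.ble (zech j) && j.ble (logAdd i j) && j.ble (zech (logAdd i j))

/-- Adds the elements of a list to a set of numbers encoded by the bits of `m`; fails if the list
has duplicates or meets the set. -/
def insertAll : List ℕ → ℕ → Option ℕ
  | [], m => some m
  | d :: l, m => if m.testBit d then none else insertAll l (m ||| 1 <<< d)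

/-- Searches for `n` planes with pairwise disjoint ratio sets that partition the exponents not
recorded in the bits of `m`. -/
def search : ℕ → ℕ → Bool
  | 0, _ => true
  | n + 1, m =>
    match (List.range' 1 126).find? fun i => !m.testBit i with
    | none => true
    | some i => (List.range 127).any fun j => isLeastLog i j &&
      match insertAll (planeRatios i j) m with
      | none => false
      | some m' => search n m'

theorem search_three : search 3 0 = false := by decide +kernel

theorem exists_insertAll_eq_some (l : List ℕ) (m : ℕ) (hl : l.Nodup)
    (hm : ∀ d ∈ l, m.testBit d = false) :
    ∃ m', insertAll l m = some m' ∧ ∀ e, m'.testBit e = true ↔ m.testBit e = true ∨ e ∈ l := by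
  induction l generalizing m with
  | nil => exact ⟨m, rfl, by simp⟩
  | cons d l ih =>
    rw [List.nodup_cons] at hl
    have hbit (e : ℕ) : (m ||| 1 <<< d).testBit e = true ↔ m.testBit e = true ∨ e = d := by
      rw [Nat.testBit_or, Nat.one_shiftLeft, Nat.testBit_two_pow, Bool.or_eq_true,
        decide_eq_true_iff, eq_comm (a := d)]
    obtain ⟨m', h₁, h₂⟩ := ih (m ||| 1 <<< d) hl.2 fun e he => by
      rw [← Bool.not_eq_true, hbit, hm e (List.mem_cons_of_mem _ he)]
      rintro (h | rfl)
      · simp at h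
      · exact hl.1 he
    refine ⟨m', ?_, fun e => ?_⟩
    · rw [insertAll, hm d List.mem_cons_self]
      exact h₁
    · rw [h₂, hbit, List.mem_cons, or_assoc]

/-- The search succeeds if a family of planes with the required ratio sets exists. -/
theorem search_eq_true {ι : Type*} [DecidableEq ι] (R : ι → Set ℕ)
    (hlt : ∀ k, ∀ d ∈ R k, d < 127)
    (hR : ∀ k, ∀ d ∈ R k, ∃ j < 127, isLeastLog d j = true ∧ (planeRatios d j).Nodup ∧
      ∀ e, e ∈ planeRatios d j ↔ e ∈ R k)
    (hpos : ∀ k, ∀ d ∈ R k, 0 < d)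
    (hdisj : ∀ k l, k ≠ l → Disjoint (R k) (R l)) (S : Finset ι) (m : ℕ)
    (hm : ∀ d, 0 < d → d < 127 → (m.testBit d = true ↔ ∀ k ∈ S, d ∉ R k)) :
    search S.card m = true := by
  induction hn : S.card generalizing S m with
  | zero => rfl
  | succ n ih =>
    rw [search]
    split
    · rfl
    · rename_i i hi
      have hbit : m.testBit i = false := by simpa using List.find?_some hi
      have hmem := List.mem_of_find?_eq_some hi
      rw [List.mem_range'_1] at hmem
      obtain ⟨k, hkS, hk⟩ : ∃ k ∈ S, i ∈ R k := by
        by_contra! h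
        rw [(hm i (by omega) (by omega)).2 h] at hbit
        cases hbit
      obtain ⟨j, hj, hleast, hnodup, hj'⟩ := hR k i hk
      have hdisjm : ∀ d ∈ planeRatios i j, m.testBit d = false := fun d hd => by
        rw [hj'] at hd
        rw [← Bool.not_eq_true, hm d (hpos k d hd) (hlt k d hd)]
        exact fun h => h k hkS hd
      obtain ⟨m', h₁, h₂⟩ := exists_insertAll_eq_some _ m hnodup hdisjm
      rw [List.any_eq_true]
      refine ⟨j, List.mem_range.2 hj, ?_⟩
      rw [hleast, h₁, Bool.true_and]
      refine ih (S.erase k) m' (fun d hd hd' => ?_) (by rw [Finset.card_erase_of_mem hkS, hn]; rfl)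
      rw [h₂, hm d hd hd', hj']
      constructor
      · rintro (h | h) l hl
        · exact h l (Finset.mem_of_mem_erase hl)
        · exact Set.disjoint_left.1 (hdisj k l (Finset.ne_of_mem_erase hl).symm) h
      · intro h
        by_cases hdk : d ∈ R k
        · exact Or.inr hdk
        · refine Or.inl fun l hl => ?_
          by_cases hlk : l = k
          · rwa [hlk]
          · exact h l (Finset.mem_erase.2 ⟨hlk, hl⟩)

/-! ### Arithmetic of the field with 128 elements -/

/-- The `i`-th power of the class of `X` modulo `X ^ 7 + X + 1`, with the coefficients of the
polynomial as binary digits. -/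
def powCode : ℕ → ℕ
  | 0 => 1
  | i + 1 => if 128 ≤ 2 * powCode i then 2 * powCode i ^^^ 131 else 2 * powCode i

theorem powCode_zech :
    ∀ i < 127, 0 < i → zech i < 127 ∧ 0 < zech i ∧ powCode (zech i) = 1 ^^^ powCode i := by
  decide +kernel

theorem powCode_lt (i : ℕ) : powCode i < 128 := by
  induction i with
  | zero => decide
  | succ i ih =>
    rw [powCode]
    split_ifs with h
    · generalize powCode i = n at *
      have : ∀ n < 128, 128 ≤ 2 * n → 2 * n ^^^ 131 < 128 := by decide +kernel
      exact this n ih h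
    · omega

section Evaluation

variable {F : Type*} [Field F]

/-- The value at `g` of the polynomial whose coefficients are the lowest eight bits of `n`. -/
def evalCode (g : F) (n : ℕ) : F :=
  ∑ k ∈ Finset.range 8, if n.testBit k then g ^ k else 0

theorem evalCode_two_mul (g : F) {n : ℕ} (hn : n < 128) :
    evalCode g (2 * n) = g * evalCode g n := by
  have h7 : n.testBit 7 = false := Nat.testBit_lt_two_pow hn
  rw [evalCode, Finset.sum_range_succ', evalCode, Finset.sum_range_succ (n := 7), h7, mul_add,
    Finset.mul_sum]
  have h0 : (2 * n).testBit 0 = false := by simp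
  rw [h0]
  simp only [Bool.false_eq_true, if_false, mul_zero, add_zero]
  refine Finset.sum_congr rfl fun k _ => ?_
  rw [Nat.testBit_succ, Nat.mul_div_cancel_left _ two_pos, mul_ite, mul_zero, pow_succ']

variable [CharP F 2]

theorem evalCode_xor (g : F) (m n : ℕ) :
    evalCode g (m ^^^ n) = evalCode g m + evalCode g n := by
  simp only [evalCode, ← Finset.sum_add_distrib]
  refine Finset.sum_congr rfl fun k _ => ?_
  rw [Nat.testBit_xor]
  cases m.testBit k <;> cases n.testBit k <;> simp [CharTwo.add_self_eq_zero]

theorem evalCode_powCode {g : F} (hg : g ^ 7 = g + 1) (i : ℕ) : evalCode g (powCode i) = g ^ i := by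
  induction i with
  | zero => simp [evalCode, powCode, Finset.sum_range_succ, Nat.testBit]
  | succ i ih =>
    have h131 : evalCode g 131 = 0 := by
      have : evalCode g 131 = 1 + g + g ^ 7 := by
        simp [evalCode, Finset.sum_range_succ, Nat.testBit]
      rw [this, hg, add_comm 1 g, CharTwo.add_self_eq_zero]
    have h := evalCode_two_mul g (powCode_lt i)
    rw [powCode, pow_succ', ← ih]
    split_ifs
    · rw [evalCode_xor, h131, add_zero, h]
    · exact h

theorem pow_zech {g : F} (hg : g ^ 7 = g + 1) {i : ℕ} (hi : 0 < i) (hi' : i < 127) :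
    g ^ zech i = 1 + g ^ i := by
  rw [← evalCode_powCode hg, (powCode_zech i hi' hi).2.2, evalCode_xor, evalCode_powCode hg,
    ← pow_zero g, ← evalCode_powCode hg 0]
  rfl

end Evaluation

section Powers

variable {F : Type*} [Field F]

theorem exists_pow_eq_of_card (hF : Nat.card F = 128) {s x : F} (hs : s ≠ 0) (hs1 : s ≠ 1)
    (hx : x ≠ 0) : ∃ n < 127, s ^ n = x := by
  have : Finite F := Nat.finite_of_card_ne_zero (by omega)
  have : Fact (Nat.Prime 127) := ⟨by norm_num⟩
  have hcard : Nat.card Fˣ = 127 := by rw [Nat.card_units, hF]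
  have hne : Units.mk0 s hs ≠ 1 := fun h => hs1 (congrArg Units.val h)
  obtain ⟨n, hn⟩ := mem_powers_of_prime_card (g' := Units.mk0 x hx) hcard hne
  refine ⟨n % 127, Nat.mod_lt _ (by norm_num), ?_⟩
  have h := congrArg Units.val (pow_mod_natCard (Units.mk0 s hs) n)
  rw [hcard] at h
  have h' := congrArg Units.val hn
  simpa using h.trans h'

theorem pow_mod_of_card (hF : Nat.card F = 128) {s : F} (hs : s ≠ 0) (n : ℕ) :
    s ^ (n % 127) = s ^ n := by
  have h := congrArg Units.val (pow_mod_natCard (Units.mk0 s hs) n)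
  rw [Nat.card_units, hF] at h
  simpa using h

theorem pow_injOn_of_card (hF : Nat.card F = 128) {s : F} (hs : s ≠ 0) (hs1 : s ≠ 1)
    {m n : ℕ} (hm : m < 127) (hn : n < 127) (h : s ^ m = s ^ n) : m = n := by
  have : Finite F := Nat.finite_of_card_ne_zero (by omega)
  have : Fact (Nat.Prime 127) := ⟨by norm_num⟩
  have hord : orderOf s = 127 := by
    refine orderOf_eq_prime ?_ hs1
    rw [← pow_mod_of_card hF hs]
    simp
  exact pow_injOn_Iio_orderOf (by simpa [hord] using hm) (by simpa [hord] using hn) h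

theorem pow_logSub (hF : Nat.card F = 128) {g : F} (hg : g ≠ 0) (p : ℕ) {q : ℕ} (hq : q < 127) :
    g ^ logSub p q = g ^ p / g ^ q := by
  rw [logSub, pow_mod_of_card hF hg, eq_div_iff (pow_ne_zero _ hg), ← pow_add,
    Nat.sub_add_cancel (by omega), ← pow_mod_of_card hF hg, Nat.add_mod_left,
    pow_mod_of_card hF hg]

theorem logSub_lt (p q : ℕ) : logSub p q < 127 := Nat.mod_lt _ (by norm_num)

theorem logAdd_lt (p q : ℕ) : logAdd p q < 127 := Nat.mod_lt _ (by norm_num)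

theorem ne_zero_of_pow_seven {g : F} (hg : g ^ 7 = g + 1) : g ≠ 0 := by
  rintro rfl
  simp at hg

theorem ne_one_of_pow_seven {g : F} (hg : g ^ 7 = g + 1) : g ≠ 1 := by
  rintro rfl
  simp at hg

variable [CharP F 2]

theorem pow_logAdd (hF : Nat.card F = 128) {g : F} (hg : g ^ 7 = g + 1) {p q : ℕ}
    (hp : p < 127) (hq : q < 127) (hpq : p ≠ q) : g ^ logAdd p q = g ^ p + g ^ q := by
  have h0 := ne_zero_of_pow_seven hg
  have hpos : 0 < logSub q p := by
    rw [logSub]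
    omega
  rw [logAdd, pow_mod_of_card hF h0, pow_add, pow_zech hg hpos (logSub_lt q p),
    pow_logSub hF h0 q hp, mul_add, mul_one, mul_div_cancel₀ _ (pow_ne_zero _ h0)]

theorem planeLogs_lt {i j : ℕ} (hi : i < 127) (hi0 : 0 < i) (hj : j < 127) (hj0 : 0 < j)
    (hs : 0 < logAdd i j) : ∀ p ∈ planeLogs i j, p < 127 := by
  simp [planeLogs, hi, hj, logAdd_lt, (powCode_zech i hi hi0).1, (powCode_zech j hj hj0).1,
    (powCode_zech _ (logAdd_lt i j) hs).1]

theorem logAdd_pos (hF : Nat.card F = 128) {g : F} (hg : g ^ 7 = g + 1) {i j : ℕ}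
    (hi : i < 127) (hj : j < 127) (hij : i ≠ j) (h1 : g ^ j ≠ 1 + g ^ i) : 0 < logAdd i j := by
  rw [Nat.pos_iff_ne_zero]
  intro h
  have := pow_logAdd hF hg hi hj hij
  rw [h, pow_zero] at this
  apply h1
  linear_combination -this - g ^ i * CharTwo.two_eq_zero (R := F)

theorem map_planeLogs (hF : Nat.card F = 128) {g : F} (hg : g ^ 7 = g + 1) {i j : ℕ}
    (hi : i < 127) (hi0 : 0 < i) (hj : j < 127) (hj0 : 0 < j) (hij : i ≠ j)
    (h1 : g ^ j ≠ 1 + g ^ i) :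
    (planeLogs i j).map (g ^ ·) = [1, g ^ i, 1 + g ^ i, g ^ j, 1 + g ^ j, g ^ i + g ^ j,
      1 + (g ^ i + g ^ j)] := by
  simp [planeLogs, pow_zech hg hi0 hi, pow_zech hg hj0 hj,
    pow_zech hg (logAdd_pos hF hg hi hj hij h1) (logAdd_lt i j), pow_logAdd hF hg hi hj hij]

theorem nodup_plane {x y : F} (hx0 : x ≠ 0) (hx1 : x ≠ 1) (hy0 : y ≠ 0) (hy1 : y ≠ 1)
    (hxy : x ≠ y) (h : y ≠ 1 + x) :
    [1, x, 1 + x, y, 1 + y, x + y, 1 + (x + y)].Nodup := by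
  have h2 : (2 : F) = 0 := CharTwo.two_eq_zero
  simp only [List.nodup_cons, List.mem_cons, List.not_mem_nil, or_false, not_or,
    List.nodup_nil, and_true, not_false_eq_true]
  refine ⟨⟨?_, ?_, ?_, ?_, ?_, ?_⟩, ⟨?_, ?_, ?_, ?_, ?_⟩, ⟨?_, ?_, ?_, ?_⟩, ⟨?_, ?_, ?_⟩,
    ⟨?_, ?_⟩, ?_⟩ <;> grind

/-- The nonzero elements of a plane containing `1` and `g ^ d`, given by their exponents. -/
theorem exists_planeLogs [Algebra (ZMod 2) F] (hF : Nat.card F = 128) {g : F}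
    (hg : g ^ 7 = g + 1) {W : Submodule (ZMod 2) F} (hW : Module.finrank (ZMod 2) W = 3)
    (h1W : (1 : F) ∈ W) {d : ℕ} (hd0 : 0 < d) (hd : d < 127) (hdW : g ^ d ∈ W) :
    ∃ j < 127, isLeastLog d j = true ∧ (planeLogs d j).Nodup ∧
      (∀ p ∈ planeLogs d j, p < 127) ∧
      ∀ a, a ∈ W ∧ a ≠ 0 ↔ ∃ p ∈ planeLogs d j, g ^ p = a := by
  classical
  have : Finite F := Nat.finite_of_card_ne_zero (by omega)
  have : Fintype F := Fintype.ofFinite F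
  have hg0 := ne_zero_of_pow_seven hg
  have hg1 := ne_one_of_pow_seven hg
  have hWcard : (W : Set F).ncard = 8 := by
    have h := Module.natCard_eq_pow_finrank (K := ZMod 2) (V := W)
    rw [hW, Nat.card_zmod] at h
    exact h
  have hd1 : g ^ d ≠ 1 := fun h => by
    have := pow_injOn_of_card hF hg0 hg1 hd (n := 0) (by norm_num) (by rw [h, pow_zero])
    omega
  have hexists : ∃ j, j < 127 ∧ g ^ j ∈ W ∧ g ^ j ≠ 1 ∧ g ^ j ≠ g ^ d ∧ g ^ j ≠ 1 + g ^ d := by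
    obtain ⟨w, hwW, hw⟩ := Set.exists_mem_notMem_of_ncard_lt_ncard
      (s := (({0, 1, g ^ d, 1 + g ^ d} : Finset F) : Set F)) (t := (W : Set F)) (by
        rw [hWcard, Set.ncard_coe_finset]
        exact Finset.card_le_four.trans_lt (by norm_num))
    simp only [Finset.coe_insert, Finset.coe_singleton, Set.mem_insert_iff,
      Set.mem_singleton_iff, not_or] at hw
    obtain ⟨j, hj, rfl⟩ := exists_pow_eq_of_card hF hg0 hg1 hw.1
    exact ⟨j, hj, hwW, hw.2⟩
  obtain ⟨hj, hjW, hj1, hjd, hjd1⟩ := Nat.find_spec hexists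
  have hmin (k : ℕ) := Nat.find_min' hexists (m := k)
  set j := Nat.find hexists
  have h2 : (2 : F) = 0 := CharTwo.two_eq_zero
  have hj0 : 0 < j := Nat.pos_of_ne_zero fun h => hj1 (by rw [h, pow_zero])
  have hdj : d ≠ j := fun h => hjd (by rw [h])
  have hpos := logAdd_pos hF hg hd hj hdj hjd1
  have hadd := pow_logAdd hF hg hd hj hdj
  have hlt := planeLogs_lt hd hd0 hj hj0 hpos
  have hmap := map_planeLogs hF hg hd hd0 hj hj0 hdj hjd1
  have hnodup := nodup_plane (pow_ne_zero d hg0) hd1 (pow_ne_zero j hg0) hj1 (Ne.symm hjd) hjd1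
  have hj00 := pow_ne_zero j hg0
  have hd00 := pow_ne_zero d hg0
  have hzj := pow_zech hg hj0 hj
  have hzs := pow_zech hg hpos (logAdd_lt d j)
  rw [hadd] at hzs
  refine ⟨j, hj, ?_, ?_, hlt, ?_⟩
  · simp only [isLeastLog, Bool.and_eq_true, Nat.ble_eq]
    refine ⟨⟨hmin _ ⟨(powCode_zech j hj hj0).1, ?_⟩, hmin _ ⟨logAdd_lt d j, ?_⟩⟩,
      hmin _ ⟨(powCode_zech _ (logAdd_lt d j) hpos).1, ?_⟩⟩
    · rw [hzj]
      exact ⟨add_mem h1W hjW, by grind, by grind, by grind⟩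
    · rw [hadd]
      exact ⟨add_mem hdW hjW, by grind, by grind, by grind⟩
    · rw [hzs]
      exact ⟨add_mem h1W (add_mem hdW hjW), by grind, by grind, by grind⟩
  · rw [← hmap] at hnodup
    exact hnodup.of_map
  · have hsub : (((planeLogs d j).map (g ^ ·)).toFinset : Set F) ⊆ (W : Set F) \ {0} := by
      intro a ha
      rw [Finset.mem_coe, List.mem_toFinset] at ha
      refine ⟨?_, ?_⟩
      · rw [hmap] at ha
        simp only [List.mem_cons, List.not_mem_nil, or_false] at ha
        rcases ha with rfl | rfl | rfl | rfl | rfl | rfl | rfl <;>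
          simp only [SetLike.mem_coe, add_mem, *]
      · obtain ⟨p, -, rfl⟩ := List.mem_map.1 ha
        exact pow_ne_zero p hg0
    have heq := Set.eq_of_subset_of_ncard_le hsub (by
      rw [Set.ncard_sdiff_singleton_of_mem W.zero_mem, hWcard, Set.ncard_coe_finset,
        List.toFinset_card_of_nodup (hmap ▸ hnodup), List.length_map]
      simp [planeLogs])
    intro a
    have := Set.ext_iff.1 heq a
    simpa [eq_comm] using this.symm

end Powers

section Root

open Polynomial

theorem X_pow_seven_add_X_add_one_dvd {K : Type*} [Field K] [CharP K 2] :
    (X ^ 7 + X + 1 : K[X]) ∣ X ^ 2 ^ 7 - X := by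
  set f : K[X] := X ^ 7 + X + 1 with hf
  have hr : AdjoinRoot.root f ^ 7 + AdjoinRoot.root f + 1 = 0 := by
    have h := AdjoinRoot.mk_self (f := f)
    rwa [hf, map_add, map_add, map_pow, map_one, AdjoinRoot.mk_X] at h
  have h2 : (2 : AdjoinRoot f) = 0 := by
    have h := congrArg (AdjoinRoot.of f) (CharTwo.two_eq_zero (R := K))
    rwa [map_zero, map_ofNat] at h
  rw [← AdjoinRoot.mk_eq_zero, map_sub, map_pow, AdjoinRoot.mk_X, sub_eq_zero]
  generalize AdjoinRoot.root f = r at hr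
  have h8 : r ^ 8 = r ^ 2 + r := by
    linear_combination r * hr - (r ^ 2 + r) * h2
  have h16 : r ^ 16 = r ^ 4 + r ^ 2 := by
    linear_combination (r ^ 8 + r ^ 2 + r) * h8 + r ^ 3 * h2
  have h32 : r ^ 32 = r ^ 4 + r ^ 2 + r := by
    linear_combination (r ^ 16 + r ^ 4 + r ^ 2) * h16 + h8 + r ^ 6 * h2
  have h64 : r ^ 64 = r ^ 4 + r := by
    linear_combination (r ^ 32 + r ^ 4 + r ^ 2 + r) * h32 + h8 +
      (r ^ 6 + r ^ 5 + r ^ 3 + r ^ 2) * h2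
  linear_combination (r ^ 64 + r ^ 4 + r) * h64 + h8 + (r ^ 5 + r ^ 2) * h2

theorem GaloisField.exists_pow_seven_eq : ∃ g : GaloisField 2 7, g ^ 7 = g + 1 := by
  have hsplits : Splits (X ^ 2 ^ 7 - X : (GaloisField 2 7)[X]) := by
    rw [← GaloisField.card 2 7 (by norm_num)]
    exact splits_X_pow_nat_card_sub_X
  have hdeg : degree (X ^ 7 + X + 1 : (GaloisField 2 7)[X]) = 7 := by compute_degree!
  obtain ⟨g, hg⟩ := (hsplits.of_dvd (FiniteField.X_pow_card_pow_sub_X_ne_zero _ (by norm_num)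
    (by norm_num)) X_pow_seven_add_X_add_one_dvd).exists_eval_eq_zero (by rw [hdeg]; norm_num)
  refine ⟨g, ?_⟩
  simp only [eval_add, eval_pow, eval_X, eval_one] at hg
  linear_combination hg - (g + 1) * CharTwo.two_eq_zero (R := GaloisField 2 7)

end Root

/-! ### Cyclic codes of planes -/

section CyclicShift

variable {K F : Type*} [Field K] [Field F] [Algebra K F]

theorem mem_cyclicShift_s8 {s : F} (hs : s ≠ 0) {V : Submodule K F} {x : F} :
    x ∈ cyclicShift K F s V ↔ s⁻¹ * x ∈ V := by
  rw [cyclicShift, Submodule.mem_map]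
  constructor
  · rintro ⟨v, hv, rfl⟩
    simpa [inv_mul_cancel_left₀ hs] using hv
  · exact fun h => ⟨_, h, by simp [mul_inv_cancel_left₀ hs]⟩

theorem cyclicShift_cyclicShift_s8 {s t : F} (hs : s ≠ 0) (ht : t ≠ 0) (V : Submodule K F) :
    cyclicShift K F s (cyclicShift K F t V) = cyclicShift K F (s * t) V := by
  ext x
  rw [mem_cyclicShift_s8 hs, mem_cyclicShift_s8 ht, mem_cyclicShift_s8 (mul_ne_zero hs ht), mul_inv_rev,
    mul_assoc]

theorem orbitOf_cyclicShift {s : F} (hs : s ≠ 0) (V : Submodule K F) :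
    orbitOf K F (cyclicShift K F s V) = orbitOf K F V := by
  ext W
  constructor
  · rintro ⟨t, ht, rfl⟩
    exact ⟨t * s, mul_ne_zero ht hs, cyclicShift_cyclicShift_s8 ht hs V⟩
  · rintro ⟨t, ht, rfl⟩
    refine ⟨t * s⁻¹, mul_ne_zero ht (inv_ne_zero hs), ?_⟩
    rw [cyclicShift_cyclicShift_s8 (mul_ne_zero ht (inv_ne_zero hs)) hs, inv_mul_cancel_right₀ hs]

/-- The ratios of distinct nonzero elements of a subspace. -/
def ratios (V : Submodule K F) : Set F :=
  (fun p : F × F => p.1 / p.2) '' ((V : Set F) \ {0}).offDiag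

theorem ratios_subset_ratios_cyclicShift {s : F} (hs : s ≠ 0) (V : Submodule K F) :
    ratios V ⊆ ratios (cyclicShift K F s V) := by
  rintro _ ⟨⟨a, b⟩, ⟨⟨ha, ha0⟩, ⟨hb, hb0⟩, hab⟩, rfl⟩
  refine ⟨(s * a, s * b), ⟨⟨?_, mul_ne_zero hs ha0⟩, ⟨?_, mul_ne_zero hs hb0⟩, ?_⟩,
    mul_div_mul_left a b hs⟩
  · exact (mem_cyclicShift_s8 hs).2 (by rwa [inv_mul_cancel_left₀ hs])
  · exact (mem_cyclicShift_s8 hs).2 (by rwa [inv_mul_cancel_left₀ hs])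
  · exact fun h => hab (mul_left_cancel₀ hs h)

theorem ratios_cyclicShift {s : F} (hs : s ≠ 0) (V : Submodule K F) :
    ratios (cyclicShift K F s V) = ratios V := by
  refine (ratios_subset_ratios_cyclicShift hs V).antisymm' ?_
  have h := ratios_subset_ratios_cyclicShift (inv_ne_zero hs) (cyclicShift K F s V)
  have h1 : cyclicShift K F 1 V = V := by
    ext
    rw [mem_cyclicShift_s8 one_ne_zero, inv_one, one_mul]
  rwa [cyclicShift_cyclicShift_s8 (inv_ne_zero hs) hs, inv_mul_cancel₀ hs, h1] at h

theorem ratios_subset (V : Submodule K F) : ratios V ⊆ {0, 1}ᶜ := by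
  rintro _ ⟨⟨a, b⟩, ⟨⟨_, ha0⟩, ⟨_, hb0⟩, hab⟩, rfl⟩
  have hb0' : b ≠ 0 := hb0
  have ha0' : a ≠ 0 := ha0
  simp only [Set.mem_compl_iff, Set.mem_insert_iff, Set.mem_singleton_iff, not_or]
  refine ⟨div_ne_zero ha0' hb0', fun h => hab ?_⟩
  rwa [div_eq_one_iff_eq hb0'] at h

theorem ncard_orbitOf_le [Finite F] (V : Submodule K F) :
    (orbitOf K F V).ncard ≤ Nat.card F - 1 := by
  have h : orbitOf K F V = (fun s => cyclicShift K F s V) '' {0}ᶜ := by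
    ext W
    simp [orbitOf, eq_comm]
  rw [h]
  refine (Set.ncard_image_le).trans ?_
  rw [Set.ncard_compl, Set.ncard_singleton]

theorem ncard_le_mul_ncard_orbitsOf [Finite F]
    (C : Set (Submodule K F)) :
    C.ncard ≤ (orbitsOf K F C).ncard * (Nat.card F - 1) := by
  classical
  have hfin : (orbitsOf K F C).Finite := Set.toFinite _
  have hsub : C ⊆ ⋃ O ∈ hfin.toFinset, O := by
    intro V hV
    simp only [Set.mem_iUnion, hfin.mem_toFinset]
    exact ⟨_, ⟨V, hV, rfl⟩, 1, one_ne_zero, by ext; simp [mem_cyclicShift_s8]⟩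
  refine (Set.ncard_le_ncard hsub).trans ((Finset.set_ncard_biUnion_le _ _).trans ?_)
  rw [Set.ncard_eq_toFinset_card _ hfin]
  refine Finset.sum_le_card_nsmul _ _ _ fun O hO => ?_
  obtain ⟨V, -, rfl⟩ := hfin.mem_toFinset.1 hO
  exact ncard_orbitOf_le V

end CyclicShift

section Code

variable {F : Type*} [Field F] [Algebra (ZMod 2) F] {C : Set (Submodule (ZMod 2) F)}

theorem eq_one_of_cyclicShift_eq (hF : Nat.card F = 128) {V : Submodule (ZMod 2) F}
    (hV : finrank (ZMod 2) V = 3) {s : F} (hs : s ≠ 0)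
    (h : cyclicShift (ZMod 2) F s V = V) : s = 1 := by
  by_contra hs1
  have : Finite F := Nat.finite_of_card_ne_zero (by omega)
  obtain ⟨v, hv, hv0⟩ := V.exists_mem_ne_zero_of_ne_bot fun hbot => by
    rw [hbot, finrank_bot] at hV
    omega
  have hpow (n : ℕ) : s ^ n * v ∈ V := by
    induction n with
    | zero => simpa
    | succ n ih =>
      rw [← h, mem_cyclicShift_s8 hs, pow_succ', mul_assoc, inv_mul_cancel_left₀ hs]
      exact ih
  have htop : V = ⊤ := by
    refine Submodule.eq_top_iff'.2 fun x => ?_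
    by_cases hx : x = 0
    · exact hx ▸ V.zero_mem
    · obtain ⟨n, -, hn⟩ := exists_pow_eq_of_card hF hs hs1 (div_ne_zero hx hv0)
      have := hpow n
      rwa [hn, div_mul_cancel₀ _ hv0] at this
  have hcard := Module.natCard_eq_pow_finrank (K := ZMod 2) (V := F)
  rw [htop, finrank_top] at hV
  rw [hV, hF, Nat.card_zmod] at hcard
  omega

theorem IsCyclicCode.cyclicShift_eq (hF : Nat.card F = 128)
    (hC : IsCyclicCode (ZMod 2) F 3 4 C) {U W : Submodule (ZMod 2) F} (hU : U ∈ C) (hW : W ∈ C)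
    {a b c d : F} (ha : a ∈ U) (hb : b ∈ U) (hc : c ∈ W) (hd : d ∈ W) (hb0 : b ≠ 0)
    (hc0 : c ≠ 0) (hd0 : d ≠ 0) (hcd : c ≠ d) (h : a / b = c / d) :
    cyclicShift (ZMod 2) F (d / b) U = W := by
  have : Finite F := Nat.finite_of_card_ne_zero (by omega)
  by_contra hne
  have hs : d / b ≠ 0 := div_ne_zero hd0 hb0
  have hshift := hC.2.1 _ hs U hU
  have hdist := hC.2.2 _ hshift W hW hne
  rw [subspaceDist, hC.1 _ hshift, hC.1 W hW] at hdist
  obtain ⟨v, hv⟩ := finrank_le_one_iff.1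
    (show finrank (ZMod 2) ↥(cyclicShift (ZMod 2) F (d / b) U ⊓ W) ≤ 1 by omega)
  have hmem : ∀ x ∈ cyclicShift (ZMod 2) F (d / b) U ⊓ W, x ≠ 0 → x = v := by
    intro x hx hx0
    obtain ⟨r, hr⟩ := hv ⟨x, hx⟩
    have hr' : r • (v : F) = x := congrArg Subtype.val hr
    obtain rfl | rfl : r = 0 ∨ r = 1 := by
      clear hr hr'
      revert r
      decide
    · exact absurd (by rw [← hr', zero_smul]) hx0
    · rw [← hr', one_smul]
  refine hcd ((hmem c ⟨(mem_cyclicShift_s8 hs).2 ?_, hc⟩ hc0).trans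
    (hmem d ⟨(mem_cyclicShift_s8 hs).2 ?_, hd⟩ hd0).symm)
  · rwa [inv_div, div_mul_eq_mul_div, mul_div_assoc, ← h, mul_div_cancel₀ _ hb0]
  · rwa [inv_div, div_mul_cancel₀ _ hd0]

/-- Every member of the code is a Sidon space. -/
theorem IsCyclicCode.injOn_div (hF : Nat.card F = 128) (hC : IsCyclicCode (ZMod 2) F 3 4 C)
    {V : Submodule (ZMod 2) F} (hV : V ∈ C) :
    Set.InjOn (fun p : F × F => p.1 / p.2) ((V : Set F) \ {0}).offDiag := by
  rintro ⟨a, b⟩ ⟨⟨ha, -⟩, ⟨hb, hb0⟩, -⟩ ⟨c, d⟩ ⟨⟨hc, hc0⟩, ⟨hd, hd0⟩, hcd⟩ h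
  simp only [Set.mem_singleton_iff, SetLike.mem_coe] at *
  have hs := eq_one_of_cyclicShift_eq hF (hC.1 V hV) (div_ne_zero hd0 hb0)
    (hC.cyclicShift_eq hF hV hV ha hb hc hd hb0 hc0 hd0 hcd h)
  rw [div_eq_one_iff_eq hb0] at hs
  subst hs
  rw [div_left_inj' hb0] at h
  rw [h]

theorem IsCyclicCode.ncard_ratios (hF : Nat.card F = 128) (hC : IsCyclicCode (ZMod 2) F 3 4 C)
    {V : Submodule (ZMod 2) F} (hV : V ∈ C) : (ratios V).ncard = 42 := by
  classical
  have : Finite F := Nat.finite_of_card_ne_zero (by omega)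
  have : Fintype F := Fintype.ofFinite F
  have hcard : ((V : Set F) \ {0}).ncard = 7 := by
    have h := Module.natCard_eq_pow_finrank (K := ZMod 2) (V := V)
    rw [hC.1 V hV, Nat.card_zmod] at h
    rw [Set.ncard_sdiff_singleton_of_mem V.zero_mem]
    exact congrArg (· - 1) h
  rw [ratios, (hC.injOn_div hF hV).ncard_image]
  rw [Set.ncard_eq_toFinset_card'] at hcard ⊢
  rw [Set.toFinset_offDiag, Finset.offDiag_card, hcard]

/-- Distinct orbits of the code have disjoint ratio sets. -/
theorem IsCyclicCode.disjoint_ratios (hF : Nat.card F = 128)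
    (hC : IsCyclicCode (ZMod 2) F 3 4 C) {U W : Submodule (ZMod 2) F} (hU : U ∈ C) (hW : W ∈ C)
    (h : orbitOf (ZMod 2) F U ≠ orbitOf (ZMod 2) F W) : Disjoint (ratios U) (ratios W) := by
  rw [Set.disjoint_left]
  rintro _ ⟨⟨a, b⟩, ⟨⟨ha, ha0⟩, ⟨hb, hb0⟩, hab⟩, rfl⟩
    ⟨⟨c, d⟩, ⟨⟨hc, hc0⟩, ⟨hd, hd0⟩, hcd⟩, heq⟩
  apply h
  rw [← hC.cyclicShift_eq hF hU hW ha hb hc hd hb0 hc0 hd0 hcd heq.symm,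
    orbitOf_cyclicShift (div_ne_zero hd0 hb0)]

theorem IsCyclicCode.exists_planeRatios [CharP F 2] (hF : Nat.card F = 128) {g : F}
    (hg : g ^ 7 = g + 1) (hC : IsCyclicCode (ZMod 2) F 3 4 C) {V : Submodule (ZMod 2) F}
    (hV : V ∈ C) {d : ℕ} (hd : d < 127) (hdV : g ^ d ∈ ratios V) :
    ∃ j < 127, isLeastLog d j = true ∧ (planeRatios d j).Nodup ∧
      ∀ e, e ∈ planeRatios d j ↔ e < 127 ∧ g ^ e ∈ ratios V := by
  have hg0 := ne_zero_of_pow_seven hg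
  have hg1 := ne_one_of_pow_seven hg
  have hd0 : 0 < d := Nat.pos_of_ne_zero fun h => ratios_subset V hdV (by simp [h])
  obtain ⟨⟨a, b⟩, ⟨⟨ha, ha0⟩, ⟨hb, hb0⟩, hab⟩, hdab⟩ := hdV
  have hb0' : b⁻¹ ≠ 0 := inv_ne_zero hb0
  rw [← ratios_cyclicShift hb0']
  have hW := hC.2.1 _ hb0' V hV
  have h1W : 1 ∈ cyclicShift (ZMod 2) F b⁻¹ V :=
    (mem_cyclicShift_s8 hb0').2 (by rwa [inv_inv, mul_one])
  have hdW : g ^ d ∈ cyclicShift (ZMod 2) F b⁻¹ V := by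
    rw [mem_cyclicShift_s8 hb0', inv_inv, ← hdab, mul_div_cancel₀ _ hb0]
    exact ha
  generalize cyclicShift (ZMod 2) F b⁻¹ V = W at *
  obtain ⟨j, hj, hleast, hnodup, hlt, hmem⟩ := exists_planeLogs hF hg (hC.1 W hW) h1W hd0 hd hdW
  have hpair : ∀ p ∈ ((planeLogs d j ×ˢ planeLogs d j).filter fun p => p.1 != p.2),
      p.1 < 127 ∧ p.2 < 127 ∧ (g ^ p.1, g ^ p.2) ∈ ((W : Set F) \ {0}).offDiag := by
    rintro ⟨p, q⟩ hpq
    rw [List.mem_filter, List.mem_product, bne_iff_ne] at hpq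
    refine ⟨hlt p hpq.1.1, hlt q hpq.1.2, (hmem _).2 ⟨p, hpq.1.1, rfl⟩,
      (hmem _).2 ⟨q, hpq.1.2, rfl⟩, fun h => hpq.2 ?_⟩
    exact pow_injOn_of_card hF hg0 hg1 (hlt p hpq.1.1) (hlt q hpq.1.2) h
  refine ⟨j, hj, hleast, ?_, fun e => ⟨fun he => ?_, fun he => ?_⟩⟩
  · refine List.Nodup.map_on ?_ ((hnodup.product hnodup).filter _)
    intro p hp q hq hpq
    obtain ⟨hp₁, hp₂, hp⟩ := hpair p hp
    obtain ⟨hq₁, hq₂, hq⟩ := hpair q hq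
    have h := hC.injOn_div hF hW hp hq (by
      simp only [← pow_logSub hF hg0 _ hp₂, ← pow_logSub hF hg0 _ hq₂, hpq])
    rw [Prod.mk.injEq] at h
    exact Prod.ext (pow_injOn_of_card hF hg0 hg1 hp₁ hq₁ h.1)
      (pow_injOn_of_card hF hg0 hg1 hp₂ hq₂ h.2)
  · obtain ⟨p, hp, rfl⟩ := List.mem_map.1 he
    obtain ⟨-, hp₂, hp⟩ := hpair p hp
    exact ⟨logSub_lt _ _, _, hp, (pow_logSub hF hg0 _ hp₂).symm⟩
  · obtain ⟨he, ⟨x, y⟩, ⟨hx, hy, hxy⟩, hexy⟩ := he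
    obtain ⟨p, hp, rfl⟩ := (hmem x).1 hx
    obtain ⟨q, hq, rfl⟩ := (hmem y).1 hy
    refine List.mem_map.2 ⟨(p, q), ?_, ?_⟩
    · rw [List.mem_filter, List.mem_product, bne_iff_ne]
      exact ⟨⟨hp, hq⟩, fun h => hxy (congrArg (g ^ ·) h)⟩
    · refine pow_injOn_of_card hF hg0 hg1 (logSub_lt _ _) he ?_
      rw [pow_logSub hF hg0 _ (hlt q hq)]
      exact hexy

theorem IsCyclicCode.ncard_orbitsOf_le_two [CharP F 2] (hF : Nat.card F = 128) {g : F}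
    (hg : g ^ 7 = g + 1) (hC : IsCyclicCode (ZMod 2) F 3 4 C) :
    (orbitsOf (ZMod 2) F C).ncard ≤ 2 := by
  classical
  have : Finite F := Nat.finite_of_card_ne_zero (by omega)
  have hg0 := ne_zero_of_pow_seven hg
  have hg1 := ne_one_of_pow_seven hg
  by_contra! hlt
  obtain ⟨_, _, _, ⟨V₀, hV₀, rfl⟩, ⟨V₁, hV₁, rfl⟩, ⟨V₂, hV₂, rfl⟩, h₀₁, h₀₂, h₁₂⟩ :=
    (Set.two_lt_ncard_iff).1 hlt
  have hd₀₁ := hC.disjoint_ratios hF hV₀ hV₁ h₀₁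
  have hd₀₂ := hC.disjoint_ratios hF hV₀ hV₂ h₀₂
  have hd₁₂ := hC.disjoint_ratios hF hV₁ hV₂ h₁₂
  have hcover : ratios V₀ ∪ ratios V₁ ∪ ratios V₂ = {0, 1}ᶜ := by
    refine Set.eq_of_subset_of_ncard_le (Set.union_subset (Set.union_subset (ratios_subset _)
      (ratios_subset _)) (ratios_subset _)) ?_
    rw [Set.ncard_union_eq (Set.disjoint_union_left.2 ⟨hd₀₂, hd₁₂⟩), Set.ncard_union_eq hd₀₁,
      hC.ncard_ratios hF hV₀, hC.ncard_ratios hF hV₁, hC.ncard_ratios hF hV₂, Set.ncard_compl,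
      Set.ncard_pair zero_ne_one, hF]
  let V : Fin 3 → Submodule (ZMod 2) F := ![V₀, V₁, V₂]
  have hV (k : Fin 3) : V k ∈ C := by fin_cases k <;> assumption
  have hdisj (k l : Fin 3) (hkl : k ≠ l) : Disjoint (ratios (V k)) (ratios (V l)) := by
    fin_cases k <;> fin_cases l <;>
      first | exact absurd rfl hkl | assumption | exact Disjoint.symm (by assumption)
  have h := search_eq_true (fun k : Fin 3 => {d | d < 127 ∧ g ^ d ∈ ratios (V k)})
    (fun k d hd => hd.1)
    (fun k d hd => hC.exists_planeRatios hF hg (hV k) hd.1 hd.2)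
    (fun k d hd => Nat.pos_of_ne_zero fun h => ratios_subset (V k) hd.2 (by simp [h]))
    (fun k l hkl => Set.disjoint_left.2 fun d hd hd' =>
      Set.disjoint_left.1 (hdisj k l hkl) hd.2 hd'.2)
    Finset.univ 0 fun d hd hd' => by
      rw [Nat.zero_testBit, Bool.false_eq_true, false_iff]
      intro hnot
      have hmem : g ^ d ∈ ratios V₀ ∪ ratios V₁ ∪ ratios V₂ := by
        rw [hcover]
        simp only [Set.mem_compl_iff, Set.mem_insert_iff, Set.mem_singleton_iff, not_or]
        refine ⟨pow_ne_zero d hg0, fun h => hd.ne' ?_⟩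
        exact pow_injOn_of_card hF hg0 hg1 hd' (by norm_num) (by rw [h, pow_zero])
      rcases hmem with (h | h) | h
      · exact hnot 0 (Finset.mem_univ _) ⟨hd', h⟩
      · exact hnot 1 (Finset.mem_univ _) ⟨hd', h⟩
      · exact hnot 2 (Finset.mem_univ _) ⟨hd', h⟩
  rw [Finset.card_fin, search_three] at h
  cases h

end Code

/-- every cyclic code in G_2(7,3) with minimum subspace distance at least 4
contains at most 2 orbits; equivalently, since every orbit in G_2(7,3) has 127 subspaces,
it has at most 254 codewords. -/
theorem C2_7_4_3_orbit_bound :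
    ∀ C : Set (Submodule (ZMod 2) (GaloisField 2 7)),
      IsCyclicCode (ZMod 2) (GaloisField 2 7) 3 4 C →
        (orbitsOf (ZMod 2) (GaloisField 2 7) C).ncard ≤ 2 ∧ C.ncard ≤ 254 := by
  intro C hC
  have hF : Nat.card (GaloisField 2 7) = 128 := GaloisField.card 2 7 (by norm_num)
  obtain ⟨g, hg⟩ := GaloisField.exists_pow_seven_eq
  have horbits := hC.ncard_orbitsOf_le_two hF hg
  refine ⟨horbits, (ncard_le_mul_ncard_orbitsOf C).trans ?_⟩
  rw [hF]
  omega
end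

section
/- 𝒞_2(8,8,4) = 17; that is, the maximum cardinality of a cyclic code C ⊆ G_2(8,4) with minimum subspace distance at least 8 equals 17, and the optimal code is a single orbit of cardinality 17. -/
open Module

theorem mem_cyclicShift_iff {Fq F : Type*} [Field Fq] [Field F] [Algebra Fq F]
    {α : F} (hα : α ≠ 0) {V : Submodule Fq F} {x : F} :
    x ∈ cyclicShift Fq F α V ↔ α⁻¹ * x ∈ V := by
  constructor
  · rintro ⟨v, hv, rfl⟩
    simpa [hα] using hv
  · exact fun h => ⟨α⁻¹ * x, h, by simp [hα]⟩

/-- A shift of a subfield by `α` is also the shift by any of its nonzero elements. -/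
theorem cyclicShift_intermediateField_eq {Fq F : Type*} [Field Fq] [Field F] [Algebra Fq F]
    (K : IntermediateField Fq F) {α x : F} (hα : α ≠ 0) (hx : x ≠ 0)
    (h : x ∈ cyclicShift Fq F α K.toSubalgebra.toSubmodule) :
    cyclicShift Fq F α K.toSubalgebra.toSubmodule =
      cyclicShift Fq F x K.toSubalgebra.toSubmodule := by
  rw [mem_cyclicShift_iff hα] at h
  replace h : α⁻¹ * x ∈ K := h
  ext y
  rw [mem_cyclicShift_iff hα, mem_cyclicShift_iff hx]
  change α⁻¹ * y ∈ K ↔ x⁻¹ * y ∈ K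
  constructor <;> intro hy
  · convert K.mul_mem (K.inv_mem h) hy using 1
    field_simp
  · convert K.mul_mem h hy using 1
    field_simp

theorem pairwise_disjoint_orbitOf_intermediateField {Fq F : Type*} [Field Fq] [Field F]
    [Algebra Fq F] (K : IntermediateField Fq F) :
    (orbitOf Fq F K.toSubalgebra.toSubmodule).Pairwise Disjoint := by
  rintro _ ⟨α, hα, rfl⟩ _ ⟨β, hβ, rfl⟩ hne
  rw [Submodule.disjoint_def]
  intro x hxα hxβ
  by_contra hx
  exact hne ((cyclicShift_intermediateField_eq K hα hx hxα).trans
    (cyclicShift_intermediateField_eq K hβ hx hxβ).symm)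

theorem two_mul_le_subspaceDist_iff_disjoint {Fq F : Type*} [Field Fq] [Field F] [Algebra Fq F]
    [FiniteDimensional Fq F] {k : ℕ} (hk : k ≠ 0) {U W : Submodule Fq F}
    (hU : finrank Fq U = k) (hW : finrank Fq W = k) :
    2 * k ≤ subspaceDist Fq F U W ↔ Disjoint U W := by
  rw [disjoint_iff, ← Submodule.finrank_eq_zero, subspaceDist, hU, hW]
  omega

theorem isCyclicCode_orbitOf_intermediateField {Fq F : Type*} [Field Fq] [Field F] [Algebra Fq F]
    [FiniteDimensional Fq F] (K : IntermediateField Fq F) :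
    IsCyclicCode Fq F (finrank Fq K) (2 * finrank Fq K)
      (orbitOf Fq F K.toSubalgebra.toSubmodule) := by
  have hdim : ∀ U ∈ orbitOf Fq F K.toSubalgebra.toSubmodule, finrank Fq U = finrank Fq K := by
    rintro _ ⟨α, hα, rfl⟩
    exact finrank_cyclicShift hα _
  refine ⟨hdim, ?_, fun U hU W hW hne => ?_⟩
  · rintro α hα _ ⟨β, hβ, rfl⟩
    exact ⟨α * β, mul_ne_zero hα hβ, cyclicShift_cyclicShift α β _⟩
  · exact (two_mul_le_subspaceDist_iff_disjoint finrank_pos.ne' (hdim U hU) (hdim W hW)).2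
      (pairwise_disjoint_orbitOf_intermediateField K hU hW hne)

/-- The number of nonzero vectors covered by a partial spread of `k`-dimensional subspaces. -/
theorem ncard_biUnion_nonzero {Fq F : Type*} [Field Fq] [Field F] [Algebra Fq F] [Finite F]
    {k : ℕ} {C : Set (Submodule Fq F)} (hdim : ∀ U ∈ C, finrank Fq U = k)
    (hC : C.Pairwise Disjoint) :
    (⋃ U ∈ C, (U : Set F) \ {0}).ncard = C.ncard * (Nat.card Fq ^ k - 1) := by
  classical
  have := Fintype.ofFinite F
  have hfin : C.Finite := C.toFinite
  lift C to Finset (Submodule Fq F) using hfin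
  have hcard : ∀ U ∈ C, ((U : Set F) \ {0}).toFinset.card = Nat.card Fq ^ k - 1 := by
    intro U hU
    rw [← Set.ncard_eq_toFinset_card', Set.ncard_sdiff_singleton_of_mem U.zero_mem,
      ← Nat.card_coe_set_eq, ← hdim U hU]
    exact congrArg (· - 1) Module.natCard_eq_pow_finrank
  have hunion : (⋃ U ∈ (C : Set (Submodule Fq F)), (U : Set F) \ {0}) =
      (C.biUnion fun U => ((U : Set F) \ {0}).toFinset : Finset F) := by
    ext x
    simp
  rw [hunion, Set.ncard_coe_finset, Set.ncard_coe_finset, Finset.card_biUnion,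
    Finset.sum_congr rfl hcard, Finset.sum_const, smul_eq_mul]
  intro U hU W hW hne
  rw [Function.onFun, Set.disjoint_toFinset, Set.disjoint_left]
  exact fun x hxU hxW => hxU.2 (Submodule.disjoint_def.1 (hC hU hW hne) x hxU.1 hxW.1)

theorem ncard_mul_le_of_isCyclicCode {Fq F : Type*} [Field Fq] [Field F] [Algebra Fq F] [Finite F]
    {k : ℕ} (hk : k ≠ 0) {C : Set (Submodule Fq F)} (hC : IsCyclicCode Fq F k (2 * k) C) :
    C.ncard * (Nat.card Fq ^ k - 1) ≤ Nat.card F - 1 := by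
  have hdisj : C.Pairwise Disjoint := fun U hU W hW hne =>
    (two_mul_le_subspaceDist_iff_disjoint hk (hC.1 U hU) (hC.1 W hW)).1 (hC.2.2 U hU W hW hne)
  rw [← ncard_biUnion_nonzero hC.1 hdisj, ← Set.ncard_univ,
    ← Set.ncard_sdiff_singleton_of_mem (Set.mem_univ (0 : F))]
  refine Set.ncard_le_ncard ?_
  exact Set.iUnion₂_subset fun U _ => Set.sdiff_subset_sdiff_left (Set.subset_univ _)

/-- The orbit of a subfield is a spread. -/
theorem ncard_orbitOf_intermediateField_mul {Fq F : Type*} [Field Fq] [Field F] [Algebra Fq F]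
    [Finite F] (K : IntermediateField Fq F) :
    (orbitOf Fq F K.toSubalgebra.toSubmodule).ncard * (Nat.card Fq ^ finrank Fq K - 1) =
      Nat.card F - 1 := by
  rw [← ncard_biUnion_nonzero (isCyclicCode_orbitOf_intermediateField K).1
    (pairwise_disjoint_orbitOf_intermediateField K), ← Set.ncard_univ,
    ← Set.ncard_sdiff_singleton_of_mem (Set.mem_univ (0 : F))]
  refine congrArg Set.ncard (Set.Subset.antisymm
    (Set.iUnion₂_subset fun U _ => Set.sdiff_subset_sdiff_left (Set.subset_univ _)) ?_)
  intro x hx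
  have hx0 : x ≠ 0 := hx.2
  refine Set.mem_iUnion₂.2 ⟨_, ⟨x, hx0, rfl⟩, ?_, hx.2⟩
  exact (mem_cyclicShift_iff hx0).2 (by simp [hx0])

theorem exists_intermediateField_galoisField_finrank_eq (p : ℕ) [Fact p.Prime] {m n : ℕ}
    (hm : m ≠ 0) (hn : n ≠ 0) (hmn : m ∣ n) :
    ∃ K : IntermediateField (ZMod p) (GaloisField p n), finrank (ZMod p) K = m := by
  obtain ⟨f⟩ := FiniteField.nonempty_algHom_of_finrank_dvd (F := ZMod p) (K := GaloisField p m)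
    (L := GaloisField p n) (by rwa [GaloisField.finrank p hm, GaloisField.finrank p hn])
  exact ⟨f.fieldRange, (AlgEquiv.ofInjectiveField f).toLinearEquiv.finrank_eq.symm.trans
    (GaloisField.finrank p hm)⟩

/-- 𝒞_2(8,8,4) = 17, and the optimal code is a single orbit of
cardinality 17. -/
theorem C2_8_8_4_eq_17 :
    IsGreatest {m : ℕ | ∃ C : Set (Submodule (ZMod 2) (GaloisField 2 8)),
      IsCyclicCode (ZMod 2) (GaloisField 2 8) 4 8 C ∧ C.ncard = m} 17 ∧
    ∃ C : Set (Submodule (ZMod 2) (GaloisField 2 8)),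
      IsCyclicCode (ZMod 2) (GaloisField 2 8) 4 8 C ∧ C.ncard = 17 ∧
      ∃ V : Submodule (ZMod 2) (GaloisField 2 8),
        C = orbitOf (ZMod 2) (GaloisField 2 8) V ∧
        (orbitOf (ZMod 2) (GaloisField 2 8) V).ncard = 17 := by
  have hF : Nat.card (GaloisField 2 8) = 256 := GaloisField.card 2 8 (by norm_num)
  obtain ⟨K, hK⟩ := exists_intermediateField_galoisField_finrank_eq 2 (m := 4) (n := 8)
    (by norm_num) (by norm_num) (by norm_num)
  have hcode := isCyclicCode_orbitOf_intermediateField K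
  have hcard := ncard_orbitOf_intermediateField_mul K
  rw [hK] at hcode hcard
  rw [hF, Nat.card_zmod] at hcard
  have hncard : (orbitOf (ZMod 2) (GaloisField 2 8) K.toSubalgebra.toSubmodule).ncard = 17 := by
    omega
  refine ⟨⟨⟨_, hcode, hncard⟩, ?_⟩, _, hcode, hncard, _, rfl, hncard⟩
  rintro m ⟨C, hC, rfl⟩
  have hle := ncard_mul_le_of_isCyclicCode (k := 4) (by norm_num) hC
  rw [hF, Nat.card_zmod] at hle
  omega
end
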